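/- Pieri rules for the spherical nonsymmetric Macdonald polynomials ℰ_n := E_n / ev(E_n): with the sign convention ± = + when n ≤ 0 and ± = − when n > 0, one has X·ℰ_n = ((t^{-1/2±1}·q^{-n} − t^{1/2})/(t^{±1}·q^{-n} − 1))·ℰ_{n+1} + ((t^{1/2} − t^{-1/2})/(t^{±1}·q^{-n} − 1))·ℰ_{1−n}, and X^{-1}·ℰ_n = ((t^{1/2±1}·q^{-n+1} − t^{-1/2})/(t^{±1}·q^{-n+1} − 1))·ℰ_{n−1} − ((t^{1/2} − t^{-1/2})/(t^{±1}·q^{-n+1} − 1))·ℰ_{1−n}, for all n ∈ ℤ. -/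

import Mathlib

/-!
Nonsymmetric Macdonald polynomials of type A₁: the explicit Laurent polynomials `E n`
are eigenfunctions of the Dunkl-type operator `Y` with eigenvalue `q^{-n_#}`.

The ground field is `F = ℚ(u,v)` with `q = u⁴`, `t = v²`; the Laurent polynomials
`F[X, X⁻¹]` are regarded inside the ambient field `M = F(X)`, in which all operators
are given by the same formulas (division by `X² - 1` is then unproblematic).
-/

noncomputable section

/-- The ground field `ℚ(u,v)`. -/
abbrev F : Type := RatFunc (RatFunc ℚ)

/-- `u`, with `q = u⁴` (so `u = q^{1/4}`). -/
def u : F := RatFunc.C RatFunc.X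

/-- `v`, with `t = v²` (so `v = t^{1/2}`). -/
def v : F := RatFunc.X

/-- `q = u⁴`. -/
def q : F := u ^ 4

/-- `t = v²`. -/
def t : F := v ^ 2

/-- The ambient field `F(X)` containing the Laurent polynomials `F[X,X⁻¹]`. -/
abbrev M : Type := RatFunc F

/-- The variable `X`. -/
def XM : M := RatFunc.X

/-- The involution `s : Xⁿ ↦ X⁻ⁿ` (the substitution `X ↦ X⁻¹`). -/
def sOp : M → M := RatFunc.eval RatFunc.C (XM⁻¹)

/-- The operator `π : Xⁿ ↦ q^{n/2} X⁻ⁿ` (the substitution `X ↦ q^{1/2} X⁻¹`). -/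
def piOp : M → M := RatFunc.eval RatFunc.C (RatFunc.C (u ^ 2) * XM⁻¹)

/-- The Demazure-Lusztig operator
`T(f) = t^{1/2}·s(f) + (t^{1/2} - t^{-1/2})·(s(f) - f)/(X² - 1)`. -/
def TOp (f : M) : M :=
  RatFunc.C v * sOp f + RatFunc.C (v - v⁻¹) * (sOp f - f) / (XM ^ 2 - 1)

/-- The operator `Y = π ∘ T`. -/
def YOp (f : M) : M := piOp (TOp f)

/-- The product `∏_{i=0}^{j-1} [(1-q^{n-i-1})(1-t qⁱ)]/[(1-q^{1+i})(1-t q^{n-i-1})]`. -/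
def macProdPos (n j : ℕ) : F :=
  ∏ i ∈ Finset.range j,
    ((1 - q ^ ((n : ℤ) - i - 1)) * (1 - t * q ^ (i : ℤ))) /
      ((1 - q ^ ((i : ℤ) + 1)) * (1 - t * q ^ ((n : ℤ) - i - 1)))

/-- The product `∏_{i=0}^{j-1} [(1-q^{n-i})(1-t qⁱ)]/[(1-q^{1+i})(1-t q^{n-i})]`. -/
def macProdNeg (n j : ℕ) : F :=
  ∏ i ∈ Finset.range j,
    ((1 - q ^ ((n : ℤ) - i)) * (1 - t * q ^ (i : ℤ))) /
      ((1 - q ^ ((i : ℤ) + 1)) * (1 - t * q ^ ((n : ℤ) - i)))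

/-- `E_n` for `n ≥ 1`. -/
def Epos (n : ℕ) : M :=
  XM ^ (n : ℤ)
    + ∑ j ∈ Finset.Icc 1 (n / 2),
        RatFunc.C (q ^ ((n : ℤ) - j) * (1 - q ^ (j : ℤ)) / (1 - q ^ ((n : ℤ) - j)) *
          macProdPos n j) * XM ^ (2 * (j : ℤ) - n)
    + ∑ j ∈ Finset.Icc 1 ((n - 1) / 2),
        RatFunc.C (q ^ (j : ℤ) * macProdPos n j) * XM ^ ((n : ℤ) - 2 * j)

/-- `E_{-n}` for `n ≥ 1`. -/
def Eneg (n : ℕ) : M :=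
  XM ^ (-(n : ℤ))
    + RatFunc.C ((1 - t) / (1 - t * q ^ (n : ℤ))) * XM ^ (n : ℤ)
    + ∑ j ∈ Finset.Icc 1 (n / 2),
        RatFunc.C (macProdNeg n j) * XM ^ (2 * (j : ℤ) - n)
    + ∑ j ∈ Finset.Icc 1 ((n - 1) / 2),
        RatFunc.C ((1 - t * q ^ (j : ℤ)) / (1 - t * q ^ ((n : ℤ) - j)) * macProdNeg n j) *
          XM ^ ((n : ℤ) - 2 * j)

/-- The nonsymmetric Macdonald polynomials `E_n`, `n ∈ ℤ`, given by the explicit formulas. -/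
def E : ℤ → M := fun n => if 0 < n then Epos n.toNat else if n = 0 then 1 else Eneg (-n).toNat

/-- The evaluation homomorphism `ev : L → F`, the `F`-algebra homomorphism `X ↦ t^{-1/2}`. -/
def ev : M → F := RatFunc.eval (RingHom.id F) (v⁻¹)

/-- The spherical nonsymmetric Macdonald polynomials `ℰ_n = E_n / ev(E_n)`. -/
def sE (n : ℤ) : M := RatFunc.C (ev (E n))⁻¹ * E n

/-- The sign `± = +1` when `n ≤ 0` and `-1` when `n > 0`. -/
def sgn (n : ℤ) : ℤ := if n ≤ 0 then 1 else -1

/-! ### Auxiliary material for the proof -/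

section Generic

variable {K : Type*} [Field K]

/-- `(t; q)_n`. -/
def pochT (q t : K) (n : ℕ) : K := ∏ i ∈ Finset.range n, (1 - t * q ^ i)

/-- `(q; q)_n`. -/
def pochQ (q : K) (n : ℕ) : K := ∏ i ∈ Finset.range n, (1 - q ^ (i + 1))

/-- The coefficients of `E_{-m}`. -/
def coefB (q t : K) (m k : ℕ) : K :=
  if k ≤ m then
    pochQ q m / (pochQ q k * pochQ q (m - k)) * pochT q t k * pochT q t (m + 1 - k) /
      pochT q t (m + 1)
  else 0

theorem pochT_succ (q t : K) (n : ℕ) : pochT q t (n + 1) = pochT q t n * (1 - t * q ^ n) :=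
  Finset.prod_range_succ _ _

theorem pochQ_succ (q : K) (n : ℕ) : pochQ q (n + 1) = pochQ q n * (1 - q ^ (n + 1)) :=
  Finset.prod_range_succ _ _

theorem pochT_zero (q t : K) : pochT q t 0 = 1 := Finset.prod_range_zero _

theorem pochQ_zero (q : K) : pochQ q 0 = 1 := Finset.prod_range_zero _

theorem pochT_ne (q t : K) (ht : ∀ i : ℕ, 1 - t * q ^ i ≠ 0) (n : ℕ) : pochT q t n ≠ 0 :=
  Finset.prod_ne_zero_iff.2 fun i _ => ht i

theorem pochQ_ne (q : K) (hq : ∀ i : ℕ, 1 - q ^ (i + 1) ≠ 0) (n : ℕ) : pochQ q n ≠ 0 :=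
  Finset.prod_ne_zero_iff.2 fun i _ => hq i

theorem coefB_add (q t : K) (a b : ℕ) :
    coefB q t (a + b) a = pochQ q (a + b) / (pochQ q a * pochQ q b) * pochT q t a *
      pochT q t (b + 1) / pochT q t (a + b + 1) := by
  have h1 : a + b - a = b := by omega
  have h2 : a + b + 1 - a = b + 1 := by omega
  rw [coefB, if_pos (by omega), h1, h2]

theorem coefB_zero (q t : K) (hq : ∀ i : ℕ, 1 - q ^ (i + 1) ≠ 0)
    (ht : ∀ i : ℕ, 1 - t * q ^ i ≠ 0) (m : ℕ) : coefB q t m 0 = 1 := by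
  have h := coefB_add q t 0 m
  rw [Nat.zero_add] at h
  rw [h, pochT_zero, pochQ_zero]
  have := pochT_ne q t ht (m + 1)
  have := pochQ_ne q hq m
  field_simp

theorem coefB_self (q t : K) (hq : ∀ i : ℕ, 1 - q ^ (i + 1) ≠ 0)
    (ht : ∀ i : ℕ, 1 - t * q ^ i ≠ 0) (m : ℕ) :
    coefB q t m m = (1 - t) / (1 - t * q ^ m) := by
  have h := coefB_add q t m 0
  rw [Nat.add_zero] at h
  rw [h, pochT_succ, pochT_succ, pochT_zero, pochQ_zero]
  have := pochT_ne q t ht m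
  have := pochQ_ne q hq m
  have := ht m
  field_simp
  try simp

/-- The key three-term relation. -/
theorem coefB_rec (q t : K) (hq : ∀ i : ℕ, 1 - q ^ (i + 1) ≠ 0)
    (ht : ∀ i : ℕ, 1 - t * q ^ i ≠ 0) (m k : ℕ) (hk : k ≤ m + 1) :
    coefB q t (m + 1) k = coefB q t m k +
      (1 - t) / (1 - t * q ^ (m + 1)) * q ^ (m + 1 - k) * coefB q t m (m + 1 - k) := by
  rcases Nat.eq_zero_or_pos k with rfl | hk0
  · rw [coefB_zero q t hq ht, coefB_zero q t hq ht]
    simp [coefB]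
  rcases Nat.lt_or_ge m k with h | h
  · obtain rfl : k = m + 1 := by omega
    rw [coefB_self q t hq ht, Nat.sub_self, coefB_zero q t hq ht]
    simp [coefB]
  obtain ⟨a, rfl⟩ : ∃ a, k = a + 1 := ⟨k - 1, by omega⟩
  obtain ⟨b, rfl⟩ := Nat.exists_eq_add_of_le h
  have e1 : a + 1 + b + 1 - (a + 1) = b + 1 := by omega
  have h1 := coefB_add q t (a + 1) (b + 1)
  have h2 := coefB_add q t (a + 1) b
  have h3 := coefB_add q t (b + 1) a
  rw [show a + 1 + (b + 1) = a + 1 + b + 1 by omega] at h1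
  rw [show b + 1 + a = a + 1 + b by omega] at h3
  rw [e1, h1, h2, h3]
  have q1 := pochQ_ne q hq a
  have q2 := pochQ_ne q hq b
  have q3 := hq a
  have q4 := hq b
  have t1 := pochT_ne q t ht (a + 1 + b + 1)
  have t2 := ht (a + 1 + b + 1)
  have t3 : 1 - q ^ (a + 1 + b + 1) * t ≠ 0 := by rwa [mul_comm]
  rw [pochQ_succ q (a + 1 + b), pochT_succ q t (a + 1 + b + 1), pochT_succ q t (b + 1),
    pochQ_succ q a, pochQ_succ q b]
  field_simp
  ring

theorem coefB_prod (q t : K) (hq : ∀ i : ℕ, 1 - q ^ (i + 1) ≠ 0)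
    (ht : ∀ i : ℕ, 1 - t * q ^ i ≠ 0) (m j : ℕ) (hj : j ≤ m) :
    ∏ i ∈ Finset.range j,
    ((1 - q ^ ((m : ℤ) - i)) * (1 - t * q ^ (i : ℤ))) /
      ((1 - q ^ ((i : ℤ) + 1)) * (1 - t * q ^ ((m : ℤ) - i))) = coefB q t m j := by
  induction j with
  | zero => rw [coefB_zero q t hq ht]; simp
  | succ j ih =>
    rw [Finset.prod_range_succ, ih (by omega)]
    obtain ⟨b, rfl⟩ := Nat.exists_eq_add_of_le hj
    have e1 : ((j + 1 + b : ℕ) : ℤ) - (j : ℤ) = ((b + 1 : ℕ) : ℤ) := by push_cast; ring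
    have e2 : (j : ℤ) + 1 = ((j + 1 : ℕ) : ℤ) := by push_cast; ring
    rw [e1, e2, zpow_natCast, zpow_natCast, zpow_natCast]
    have h1 := coefB_add q t j (b + 1)
    have h2 := coefB_add q t (j + 1) b
    rw [show j + (b + 1) = j + 1 + b by omega] at h1
    rw [h1, h2]
    have q1 := pochQ_ne q hq j
    have q2 := pochQ_ne q hq b
    have q3 := hq j
    have q4 := hq b
    have t1 := pochT_ne q t ht (j + 1 + b + 1)
    have t2 := ht (b + 1)
    have t3 : 1 - q ^ (b + 1) * t ≠ 0 := by rwa [mul_comm]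
    rw [pochT_succ q t (b + 1), pochT_succ q t j, pochQ_succ q j, pochQ_succ q b]
    field_simp

/-- Reflection used for `E_{m+1}`. -/
theorem coefB_refl_pos (q t : K) (hq : ∀ i : ℕ, 1 - q ^ (i + 1) ≠ 0)
    (m j : ℕ) (hj0 : 1 ≤ j) (hj : j ≤ m) :
    coefB q t m (m + 1 - j) = (1 - q ^ j) / (1 - q ^ (m + 1 - j)) * coefB q t m j := by
  obtain ⟨a, rfl⟩ : ∃ a, j = a + 1 := ⟨j - 1, by omega⟩
  obtain ⟨b, rfl⟩ := Nat.exists_eq_add_of_le hj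
  have h2 := coefB_add q t (a + 1) b
  have h3 := coefB_add q t (b + 1) a
  rw [show b + 1 + a = a + 1 + b by omega] at h3
  rw [show a + 1 + b + 1 - (a + 1) = b + 1 by omega, h2, h3]
  have q1 := pochQ_ne q hq a
  have q2 := pochQ_ne q hq b
  have q3 := hq a
  have q4 := hq b
  rw [pochQ_succ q a, pochQ_succ q b]
  field_simp

/-- Reflection used for `E_{-m}`. -/
theorem coefB_refl_neg (q t : K) (ht : ∀ i : ℕ, 1 - t * q ^ i ≠ 0)
    (m j : ℕ) (hj : j ≤ m) :
    coefB q t m (m - j) = (1 - t * q ^ j) / (1 - t * q ^ (m - j)) * coefB q t m j := by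
  obtain ⟨b, rfl⟩ := Nat.exists_eq_add_of_le hj
  have h2 := coefB_add q t j b
  have h3 := coefB_add q t b j
  rw [show b + j = j + b by omega] at h3
  rw [show j + b - j = b by omega, h2, h3]
  have t2 := ht b
  rw [pochT_succ q t j, pochT_succ q t b]
  field_simp

theorem sum_Icc_one {A : Type*} [AddCommMonoid A] (f : ℕ → A) (a : ℕ) :
    ∑ j ∈ Finset.Icc 1 a, f j = ∑ i ∈ Finset.range a, f (i + 1) := by
  have : Finset.Icc 1 a = Finset.Ico 1 (a + 1) := by
    ext x
    rw [Finset.mem_Icc, Finset.mem_Ico]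
    omega
  rw [this, Finset.sum_Ico_eq_sum_range]
  simp [Nat.add_comm]

theorem sum_split {A : Type*} [AddCommMonoid A] (f : ℕ → A) (m : ℕ) :
    ∑ k ∈ Finset.range (m + 1), f k = f 0 + ∑ j ∈ Finset.Icc 1 ((m + 1) / 2), f (m + 1 - j)
      + ∑ j ∈ Finset.Icc 1 (m / 2), f j := by
  rw [Finset.sum_range_succ', sum_Icc_one, sum_Icc_one]
  have h := Finset.sum_range_add (fun i => f (i + 1)) (m / 2) ((m + 1) / 2)
  rw [show m / 2 + (m + 1) / 2 = m by omega] at h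
  rw [h, ← Finset.sum_range_reflect _ ((m + 1) / 2)]
  have : ∀ i ∈ Finset.range ((m + 1) / 2),
      f (m / 2 + ((m + 1) / 2 - 1 - i) + 1) = f (m + 1 - (i + 1)) := by
    intro i hi
    rw [Finset.mem_range] at hi
    congr 1
    omega
  rw [Finset.sum_congr rfl this]
  abel

theorem sum_split_neg {A : Type*} [AddCommMonoid A] (f : ℕ → A) (m : ℕ) (hm : 1 ≤ m) :
    ∑ k ∈ Finset.range (m + 1), f k = f 0 + f m + ∑ j ∈ Finset.Icc 1 (m / 2), f j
      + ∑ j ∈ Finset.Icc 1 ((m - 1) / 2), f (m - j) := by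
  obtain ⟨p, rfl⟩ : ∃ p, m = p + 1 := ⟨m - 1, by omega⟩
  rw [← Finset.sum_range_reflect, Finset.sum_range_succ, sum_split]
  have : ∀ i ∈ Finset.Icc 1 ((p + 1) / 2),
      f (p + 1 + 1 - 1 - (p + 1 - i)) = f i := by
    intro i hi
    rw [Finset.mem_Icc] at hi
    congr 1
    omega
  rw [Finset.sum_congr rfl this]
  simp only [Nat.add_sub_cancel, Nat.sub_zero, Nat.sub_self]
  abel

end Generic

theorem v_ne : v ≠ 0 := RatFunc.X_ne_zero

theorem u_ne : u ≠ 0 := by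
  unfold u
  rw [Ne, map_eq_zero_iff _ RatFunc.C_injective]
  exact RatFunc.X_ne_zero

theorem q_ne : q ≠ 0 := pow_ne_zero _ u_ne

theorem t_ne : t ≠ 0 := pow_ne_zero _ v_ne

theorem intDegree_pow' {K : Type*} [Field K] (x : RatFunc K) (hx : x ≠ 0) (n : ℕ) :
    (x ^ n).intDegree = n * x.intDegree := by
  induction n with
  | zero => simp
  | succ n ih => rw [pow_succ, RatFunc.intDegree_mul (pow_ne_zero _ hx) hx, ih]; push_cast; ring

theorem hq_ne (i : ℕ) : 1 - q ^ (i + 1) ≠ 0 := by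
  intro h
  have h1 : RatFunc.C ((RatFunc.X : RatFunc ℚ) ^ (4 * (i + 1))) = (RatFunc.C 1 : F) := by
    rw [map_pow, map_one, pow_mul]
    exact (sub_eq_zero.1 h).symm
  have h2 := congrArg RatFunc.intDegree (RatFunc.C_injective h1)
  rw [intDegree_pow' _ RatFunc.X_ne_zero, RatFunc.intDegree_X, RatFunc.intDegree_one] at h2
  omega

theorem htt_ne (p i : ℕ) : 1 - t ^ (p + 1) * q ^ i ≠ 0 := by
  intro h
  have h1 : (RatFunc.X : F) ^ (2 * (p + 1)) * RatFunc.C ((RatFunc.X : RatFunc ℚ) ^ (4 * i)) = 1 := by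
    rw [map_pow, pow_mul, pow_mul]
    exact (sub_eq_zero.1 h).symm
  have h2 := congrArg RatFunc.intDegree h1
  rw [RatFunc.intDegree_mul (pow_ne_zero _ RatFunc.X_ne_zero)
      ((map_ne_zero_iff _ RatFunc.C_injective).2 (pow_ne_zero _ RatFunc.X_ne_zero)),
    intDegree_pow' _ RatFunc.X_ne_zero, RatFunc.intDegree_X, RatFunc.intDegree_C,
    RatFunc.intDegree_one] at h2
  omega

theorem ht_ne (i : ℕ) : 1 - t * q ^ i ≠ 0 := by
  have := htt_ne 0 i
  simpa using this

theorem macProdPos_eq (m j : ℕ) (hj : j ≤ m) : macProdPos (m + 1) j = coefB q t m j := by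
  rw [← coefB_prod q t hq_ne ht_ne m j hj, macProdPos]
  refine Finset.prod_congr rfl fun i _ => ?_
  rw [show ((m + 1 : ℕ) : ℤ) - i - 1 = (m : ℤ) - i by push_cast; ring]

theorem macProdNeg_eq (m j : ℕ) (hj : j ≤ m) : macProdNeg m j = coefB q t m j :=
  coefB_prod q t hq_ne ht_ne m j hj

theorem Epos_eq (m : ℕ) : Epos (m + 1) = ∑ k ∈ Finset.range (m + 1),
    RatFunc.C (q ^ k * coefB q t m k) * XM ^ ((m : ℤ) + 1 - 2 * k) := by
  rw [sum_split, Epos]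
  congr 1
  · congr 1
    · rw [coefB_zero q t hq_ne ht_ne]
      simp
    · refine Finset.sum_congr rfl fun j hj => ?_
      rw [Finset.mem_Icc] at hj
      have e : ((m + 1 : ℕ) : ℤ) - j = ((m + 1 - j : ℕ) : ℤ) := by omega
      rw [e, zpow_natCast, zpow_natCast]
      congr 2
      · by_cases hm : j ≤ m
        · rw [macProdPos_eq m j hm, coefB_refl_pos q t hq_ne m j hj.1 hm]
          ring
        · omega
      · omega
  · rw [Nat.add_sub_cancel]
    refine Finset.sum_congr rfl fun j hj => ?_
    rw [Finset.mem_Icc] at hj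
    rw [macProdPos_eq m j (by omega), zpow_natCast]
    push_cast
    rfl

theorem Eneg_eq (m : ℕ) (hm : 1 ≤ m) : Eneg m = ∑ k ∈ Finset.range (m + 1),
    RatFunc.C (coefB q t m k) * XM ^ (2 * (k : ℤ) - m) := by
  rw [sum_split_neg _ _ hm, Eneg]
  congr 1
  · congr 1
    · congr 1
      · rw [coefB_zero q t hq_ne ht_ne]
        simp
      · rw [coefB_self q t hq_ne ht_ne, zpow_natCast]
        congr 2
        omega
    · refine Finset.sum_congr rfl fun j hj => ?_
      rw [Finset.mem_Icc] at hj
      rw [macProdNeg_eq m j (by omega)]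
  · refine Finset.sum_congr rfl fun j hj => ?_
    rw [Finset.mem_Icc] at hj
    have e : (m : ℤ) - j = ((m - j : ℕ) : ℤ) := by omega
    rw [macProdNeg_eq m j (by omega), coefB_refl_neg q t ht_ne m j (by omega), e, zpow_natCast,
      zpow_natCast]
    congr 2
    omega

theorem E_pos_eq (m : ℕ) : E ((m : ℤ) + 1) = ∑ k ∈ Finset.range (m + 1),
    RatFunc.C (q ^ k * coefB q t m k) * XM ^ ((m : ℤ) + 1 - 2 * k) := by
  rw [← Epos_eq, E, if_pos (by omega)]
  congr 1

theorem E_neg_eq (m : ℕ) : E (-(m : ℤ)) = ∑ k ∈ Finset.range (m + 1),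
    RatFunc.C (coefB q t m k) * XM ^ (2 * (k : ℤ) - m) := by
  rw [E, if_neg (by omega)]
  rcases Nat.eq_zero_or_pos m with rfl | hm
  · simp [coefB_zero q t hq_ne ht_ne]
  · rw [if_neg (by omega), ← Eneg_eq m hm]
    congr 1
    omega

theorem XM_ne : XM ≠ 0 := RatFunc.X_ne_zero

theorem XM_zpow_sub (n : ℤ) : XM ^ (n - 1) = XM ^ n * XM⁻¹ :=
  zpow_sub_one₀ (G₀ := M) (a := XM) XM_ne n

theorem XM_zpow_add (n : ℤ) : XM ^ (n + 1) = XM ^ n * XM :=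
  zpow_add_one₀ (G₀ := M) (a := XM) XM_ne n

theorem sum_ext_pos (m : ℕ) : E ((m : ℤ) + 1) = ∑ k ∈ Finset.range (m + 1 + 1),
    RatFunc.C (q ^ k * coefB q t m k) * XM ^ ((m : ℤ) + 1 - 2 * k) := by
  rw [E_pos_eq, Finset.sum_range_succ _ (m + 1)]
  simp [coefB]

theorem sum_ext_neg (m : ℕ) : E (-(m : ℤ)) = ∑ k ∈ Finset.range (m + 1 + 1),
    RatFunc.C (coefB q t m k) * XM ^ (2 * (k : ℤ) - m) := by
  rw [E_neg_eq, Finset.sum_range_succ _ (m + 1)]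
  simp [coefB]

theorem rec_neg (m : ℕ) : E (-((m + 1 : ℕ) : ℤ)) = XM⁻¹ * E (-(m : ℤ)) +
    RatFunc.C ((1 - t) / (1 - t * q ^ (m + 1))) * E ((m : ℤ) + 1) := by
  have h2 := sum_ext_pos m
  rw [← Finset.sum_range_reflect] at h2
  rw [h2, sum_ext_neg m, E_neg_eq (m + 1), Finset.mul_sum, Finset.mul_sum, ← Finset.sum_add_distrib]
  refine Finset.sum_congr rfl fun k hk => ?_
  rw [Finset.mem_range] at hk
  rw [show m + 1 + 1 - 1 - k = m + 1 - k by omega,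
    show (m : ℤ) + 1 - 2 * ((m + 1 - k : ℕ) : ℤ) = 2 * (k : ℤ) - m - 1 by omega,
    show 2 * (k : ℤ) - ((m + 1 : ℕ) : ℤ) = 2 * (k : ℤ) - m - 1 by omega,
    XM_zpow_sub, coefB_rec q t hq_ne ht_ne m k (by omega)]
  simp only [map_add, map_mul]
  ring

theorem rec_pos (m : ℕ) : E (((m + 1 : ℕ) : ℤ) + 1) = XM * E ((m : ℤ) + 1) +
    RatFunc.C (q ^ (m + 1) * ((1 - t) / (1 - t * q ^ (m + 1)))) * E (-(m : ℤ)) := by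
  have h2 := sum_ext_neg m
  rw [← Finset.sum_range_reflect] at h2
  rw [h2, sum_ext_pos m, E_pos_eq (m + 1), Finset.mul_sum, Finset.mul_sum, ← Finset.sum_add_distrib]
  refine Finset.sum_congr rfl fun k hk => ?_
  rw [Finset.mem_range] at hk
  have e : q ^ (m + 1) = q ^ k * q ^ (m + 1 - k) := by rw [← pow_add]; congr 1; omega
  have e' : RatFunc.C (q ^ (m + 1) * ((1 - t) / (1 - t * q ^ (m + 1)))) =
      RatFunc.C (q ^ k * q ^ (m + 1 - k)) * RatFunc.C ((1 - t) / (1 - t * q ^ (m + 1))) := by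
    rw [← e, map_mul]
  rw [e', show m + 1 + 1 - 1 - k = m + 1 - k by omega,
    show 2 * ((m + 1 - k : ℕ) : ℤ) - (m : ℤ) = (m : ℤ) + 1 - 2 * k + 1 by omega,
    show ((m + 1 : ℕ) : ℤ) + 1 - 2 * (k : ℤ) = (m : ℤ) + 1 - 2 * k + 1 by omega,
    XM_zpow_add, coefB_rec q t hq_ne ht_ne m k (by omega)]
  simp only [map_add, map_mul]
  ring

/-- The denominator of `f` does not vanish at `t^{-1/2}`. -/
def Good (f : M) : Prop := Polynomial.eval₂ (RingHom.id F) (v⁻¹) (RatFunc.denom f) ≠ 0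

theorem Good.add {f g : M} (hf : Good f) (hg : Good g) : Good (f + g) := fun h => by
  have := Polynomial.eval₂_eq_zero_of_dvd_of_eval₂_eq_zero _ _ (RatFunc.denom_add_dvd f g) h
  rw [Polynomial.eval₂_mul] at this
  exact mul_ne_zero hf hg this

theorem Good.mul {f g : M} (hf : Good f) (hg : Good g) : Good (f * g) := fun h => by
  have := Polynomial.eval₂_eq_zero_of_dvd_of_eval₂_eq_zero _ _ (RatFunc.denom_mul_dvd f g) h
  rw [Polynomial.eval₂_mul] at this
  exact mul_ne_zero hf hg this

theorem good_C (c : F) : Good (RatFunc.C c) := by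
  rw [Good, RatFunc.denom_C, Polynomial.eval₂_one]
  exact one_ne_zero

theorem good_X : Good XM := by
  rw [Good, XM, RatFunc.denom_X, Polynomial.eval₂_one]
  exact one_ne_zero

theorem good_X_inv : Good XM⁻¹ := fun h => by
  have := Polynomial.eval₂_eq_zero_of_dvd_of_eval₂_eq_zero _ _ (RatFunc.denom_inv_dvd XM_ne) h
  rw [XM, RatFunc.num_X, Polynomial.eval₂_X] at this
  exact inv_ne_zero v_ne this

theorem ev_add {f g : M} (hf : Good f) (hg : Good g) : ev (f + g) = ev f + ev g :=
  RatFunc.eval_add _ _ hf hg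

theorem ev_mul {f g : M} (hf : Good f) (hg : Good g) : ev (f * g) = ev f * ev g :=
  RatFunc.eval_mul _ _ hf hg

theorem ev_C (c : F) : ev (RatFunc.C c) = c := RatFunc.eval_C _ _

theorem ev_X : ev XM = v⁻¹ := RatFunc.eval_X _ _

theorem ev_X_inv : ev XM⁻¹ = v := by
  have h := ev_mul good_X good_X_inv
  have h1 : ev (XM * XM⁻¹) = 1 := by
    rw [RatFunc.mul_inv_cancel XM_ne, ← map_one RatFunc.C, ev_C]
  rw [h1, ev_X] at h
  have h2 := congrArg (fun x => v * x) h
  rw [mul_one, ← mul_assoc, mul_inv_cancel₀ v_ne, one_mul] at h2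
  exact h2.symm

theorem E_zero : E (-((0 : ℕ) : ℤ)) = RatFunc.C 1 := by
  simp [E]

theorem E_one : E (((0 : ℕ) : ℤ) + 1) = XM := by
  rw [E_pos_eq]
  simp [coefB_zero q t hq_ne ht_ne]

theorem good_E (m : ℕ) : Good (E ((m : ℤ) + 1)) ∧ Good (E (-(m : ℤ))) := by
  induction m with
  | zero =>
    rw [E_zero, E_one]
    exact ⟨good_X, good_C 1⟩
  | succ m ih =>
    rw [rec_pos, rec_neg]
    exact ⟨(good_X.mul ih.1).add ((good_C _).mul ih.2),
      (good_X_inv.mul ih.2).add ((good_C _).mul ih.1)⟩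

theorem ev_rec_pos (m : ℕ) : ev (E (((m + 1 : ℕ) : ℤ) + 1)) = v⁻¹ * ev (E ((m : ℤ) + 1)) +
    q ^ (m + 1) * ((1 - t) / (1 - t * q ^ (m + 1))) * ev (E (-(m : ℤ))) := by
  obtain ⟨h1, h2⟩ := good_E m
  rw [rec_pos, ev_add (good_X.mul h1) ((good_C _).mul h2), ev_mul good_X h1,
    ev_mul (good_C _) h2, ev_C, ev_X]

theorem ev_rec_neg (m : ℕ) : ev (E (-((m + 1 : ℕ) : ℤ))) = v * ev (E (-(m : ℤ))) +
    (1 - t) / (1 - t * q ^ (m + 1)) * ev (E ((m : ℤ) + 1)) := by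
  obtain ⟨h1, h2⟩ := good_E m
  rw [rec_neg, ev_add (good_X_inv.mul h2) ((good_C _).mul h1), ev_mul good_X_inv h2,
    ev_mul (good_C _) h1, ev_C, ev_X_inv]

theorem ev_scalar {K : Type*} [Field K] (v Q e : K) (hv : v ≠ 0) (h : 1 - v ^ 2 * Q ≠ 0) :
    v * e + (1 - v ^ 2) / (1 - v ^ 2 * Q) * (v⁻¹ * e) =
      (1 - v ^ 4 * Q) / (v * (1 - v ^ 2 * Q)) * e := by
  field_simp
  ring

theorem ev_scalar' {K : Type*} [Field K] (v Q e : K) (hv : v ≠ 0) (h : 1 - v ^ 2 * Q ≠ 0) :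
    v⁻¹ * (v⁻¹ * e) + Q * ((1 - v ^ 2) / (1 - v ^ 2 * Q)) * e =
      v⁻¹ * (v * e + (1 - v ^ 2) / (1 - v ^ 2 * Q) * (v⁻¹ * e)) := by
  field_simp
  ring

theorem ev_pos (m : ℕ) : ev (E ((m : ℤ) + 1)) = v⁻¹ * ev (E (-(m : ℤ))) := by
  induction m with
  | zero => rw [E_zero, E_one, ev_C, ev_X, mul_one]
  | succ m ih =>
    rw [ev_rec_pos, ev_rec_neg, ih]
    exact ev_scalar' v (q ^ (m + 1)) _ v_ne (ht_ne (m + 1))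

theorem ev_neg_succ (m : ℕ) : ev (E (-((m + 1 : ℕ) : ℤ))) =
    (1 - v ^ 4 * q ^ (m + 1)) / (v * (1 - v ^ 2 * q ^ (m + 1))) * ev (E (-(m : ℤ))) := by
  rw [ev_rec_neg, ev_pos]
  exact ev_scalar v (q ^ (m + 1)) _ v_ne (ht_ne (m + 1))

theorem ht2_ne (m : ℕ) : 1 - v ^ 4 * q ^ m ≠ 0 := by
  have := htt_ne 1 m
  rwa [t, ← pow_mul] at this

theorem ev_neg_ne (m : ℕ) : ev (E (-(m : ℤ))) ≠ 0 := by
  induction m with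
  | zero => rw [E_zero, ev_C]; exact one_ne_zero
  | succ m ih =>
    rw [ev_neg_succ]
    exact mul_ne_zero (div_ne_zero (ht2_ne _) (mul_ne_zero v_ne (ht_ne (m + 1)))) ih

theorem sE_pos (m : ℕ) : sE ((m : ℤ) + 1) =
    RatFunc.C (v / ev (E (-(m : ℤ)))) * E ((m : ℤ) + 1) := by
  rw [sE, ev_pos, mul_inv, inv_inv, div_eq_mul_inv]

theorem lin1 {K L : Type*} [Field K] [Field L] (c : K →+* L) (X a b A : L) (x y z w k1 k2 : K)
    (hA : A = X * a + c w * b) (s1 : k1 * y = x) (s2 : k2 * z = -(x * w)) :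
    X * (c x * a) = c k1 * (c y * A) + c k2 * (c z * b) := by
  have s1' := congrArg c s1
  have s2' := congrArg c s2
  rw [map_mul] at s1'
  rw [map_neg, map_mul, map_mul] at s2'
  linear_combination -c x * hA - A * s1' - b * s2'

theorem lin2 {K L : Type*} [Field K] [Field L] (c : K →+* L) (X a b A B : L) (hX : X ≠ 0)
    (x y z w w' k1 k2 : K)
    (hA : A = X * a + c w * b) (hB : B = X⁻¹ * b + c w' * a)
    (s1 : k1 * y = x * (1 - w * w')) (s2 : k2 * z = x * w') :
    X * (c x * B) = c k1 * (c y * b) + c k2 * (c z * A) := by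
  have s1' := congrArg c s1
  have s2' := congrArg c s2
  simp only [map_sub, map_one, map_mul] at s1' s2'
  have hB' : X * B = b + c w' * (X * a) := by
    rw [hB]
    field_simp
  linear_combination c x * hB' - c x * c w' * hA - b * s1' - A * s2'

section Scalars

variable {K : Type*} [Field K] (v Q e : K)

theorem sc1 (hv : v ≠ 0) (hQ : Q ≠ 0) (he : e ≠ 0) (h : 1 - v ^ 2 * Q ≠ 0)
    (h' : 1 - v ^ 4 * Q ≠ 0) :
    ((v ^ 3)⁻¹ * Q⁻¹ - v) / ((v ^ 2)⁻¹ * Q⁻¹ - 1) *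
      (v / ((1 - v ^ 4 * Q) / (v * (1 - v ^ 2 * Q)) * e)) = v / e := by
  have : (v ^ 2)⁻¹ * Q⁻¹ - 1 = (1 - v ^ 2 * Q) / (v ^ 2 * Q) := by field_simp
  rw [this]
  field_simp

theorem sc2 (hv : v ≠ 0) (hQ : Q ≠ 0) (he : e ≠ 0) (h : 1 - v ^ 2 * Q ≠ 0) :
    (v - v⁻¹) / ((v ^ 2)⁻¹ * Q⁻¹ - 1) * e⁻¹ =
      -(v / e * (Q * ((1 - v ^ 2) / (1 - v ^ 2 * Q)))) := by
  have : (v ^ 2)⁻¹ * Q⁻¹ - 1 = (1 - v ^ 2 * Q) / (v ^ 2 * Q) := by field_simp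
  rw [this]
  field_simp
  ring

theorem sc3 (hv : v ≠ 0) (he : e ≠ 0) (h : 1 - v ^ 2 * Q ≠ 0)
    (h' : 1 - v ^ 4 * Q ≠ 0) :
    (v * Q - v) / (v ^ 2 * Q - 1) * e⁻¹ =
      ((1 - v ^ 4 * Q) / (v * (1 - v ^ 2 * Q)) * e)⁻¹ *
      (1 - Q * ((1 - v ^ 2) / (1 - v ^ 2 * Q)) * ((1 - v ^ 2) / (1 - v ^ 2 * Q))) := by
  rw [show v ^ 2 * Q - 1 = -(1 - v ^ 2 * Q) by ring]
  field_simp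
  ring

theorem sc4 (hv : v ≠ 0) (h : 1 - v ^ 2 * Q ≠ 0) :
    (v - v⁻¹) / (v ^ 2 * Q - 1) * (v / e) = e⁻¹ * ((1 - v ^ 2) / (1 - v ^ 2 * Q)) := by
  rw [show v ^ 2 * Q - 1 = -(1 - v ^ 2 * Q) by ring]
  by_cases he : e = 0
  · simp [he]
  field_simp
  ring

theorem sc5 (hv : v ≠ 0) (hQ : Q ≠ 0) (he : e ≠ 0) (h : 1 - v ^ 2 * Q ≠ 0)
    (h' : 1 - v ^ 4 * Q ≠ 0) :
    (v⁻¹ * Q⁻¹ - v⁻¹) / ((v ^ 2)⁻¹ * Q⁻¹ - 1) * (v / e) =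
      (v / ((1 - v ^ 4 * Q) / (v * (1 - v ^ 2 * Q)) * e)) *
      (1 - (1 - v ^ 2) / (1 - v ^ 2 * Q) * (Q * ((1 - v ^ 2) / (1 - v ^ 2 * Q)))) := by
  have : (v ^ 2)⁻¹ * Q⁻¹ - 1 = (1 - v ^ 2 * Q) / (v ^ 2 * Q) := by field_simp
  rw [this]
  field_simp
  ring

theorem sc7 (hv : v ≠ 0) (he : e ≠ 0) (h : 1 - v ^ 2 * Q ≠ 0)
    (h' : 1 - v ^ 4 * Q ≠ 0) :
    (v ^ 3 * Q - v⁻¹) / (v ^ 2 * Q - 1) *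
      ((1 - v ^ 4 * Q) / (v * (1 - v ^ 2 * Q)) * e)⁻¹ = e⁻¹ := by
  rw [show v ^ 2 * Q - 1 = -(1 - v ^ 2 * Q) by ring]
  field_simp
  ring

end Scalars

theorem pieri1 (p : ℕ) : XM * sE ((p : ℤ) + 1) =
    RatFunc.C (((v ^ 3)⁻¹ * (q ^ (p + 1))⁻¹ - v) / ((v ^ 2)⁻¹ * (q ^ (p + 1))⁻¹ - 1)) *
      sE (((p + 1 : ℕ) : ℤ) + 1) +
    RatFunc.C ((v - v⁻¹) / ((v ^ 2)⁻¹ * (q ^ (p + 1))⁻¹ - 1)) * sE (-(p : ℤ)) := by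
  rw [sE_pos, sE_pos, sE, ev_neg_succ]
  have hQ : q ^ (p + 1) ≠ 0 := pow_ne_zero _ q_ne
  exact lin1 _ _ _ _ _ _ _ _ _ _ _ (rec_pos p)
    (sc1 _ _ _ v_ne hQ (ev_neg_ne p) (ht_ne (p + 1)) (ht2_ne (p + 1)))
    (sc2 _ _ _ v_ne hQ (ev_neg_ne p) (ht_ne (p + 1)))

theorem pieri2 (p : ℕ) : XM * sE (-((p + 1 : ℕ) : ℤ)) =
    RatFunc.C ((v * q ^ (p + 1) - v) / (v ^ 2 * q ^ (p + 1) - 1)) * sE (-(p : ℤ)) +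
    RatFunc.C ((v - v⁻¹) / (v ^ 2 * q ^ (p + 1) - 1)) * sE (((p + 1 : ℕ) : ℤ) + 1) := by
  rw [sE_pos, sE, sE, ev_neg_succ]
  exact lin2 _ _ _ _ _ _ XM_ne _ _ _ _ _ _ _ (rec_pos p) (rec_neg p)
    (sc3 _ _ _ v_ne (ev_neg_ne p) (ht_ne (p + 1)) (ht2_ne (p + 1)))
    (sc4 _ _ _ v_ne (ht_ne (p + 1)))

theorem pieri3 (p : ℕ) : XM⁻¹ * sE (((p + 1 : ℕ) : ℤ) + 1) =
    RatFunc.C ((v⁻¹ * (q ^ (p + 1))⁻¹ - v⁻¹) / ((v ^ 2)⁻¹ * (q ^ (p + 1))⁻¹ - 1)) *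
      sE ((p : ℤ) + 1) -
    RatFunc.C ((v - v⁻¹) / ((v ^ 2)⁻¹ * (q ^ (p + 1))⁻¹ - 1)) * sE (-((p + 1 : ℕ) : ℤ)) := by
  have hQ : q ^ (p + 1) ≠ 0 := pow_ne_zero _ q_ne
  have hX : XM⁻¹ ≠ 0 := fun h => by
    have h1 := RatFunc.mul_inv_cancel XM_ne
    rw [h, mul_zero] at h1
    exact zero_ne_one h1
  rw [sub_eq_add_neg, ← neg_mul, ← map_neg, sE_pos, sE_pos, sE]
  refine lin2 _ _ _ _ _ _ hX _ _ _ _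
    (q ^ (p + 1) * ((1 - t) / (1 - t * q ^ (p + 1)))) _ _ (rec_neg p) ((rec_pos p).trans ?_) ?_ ?_
  · exact congrArg (fun x => x * E ((p : ℤ) + 1) +
      RatFunc.C (q ^ (p + 1) * ((1 - t) / (1 - t * q ^ (p + 1)))) * E (-(p : ℤ)))
      (inv_inv (G := M) XM).symm
  · rw [ev_neg_succ]
    exact sc5 _ _ _ v_ne hQ (ev_neg_ne p) (ht_ne (p + 1)) (ht2_ne (p + 1))
  · rw [neg_mul, sc2 _ _ _ v_ne hQ (ev_neg_ne (p + 1)) (ht_ne (p + 1)), neg_neg]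
    rfl

theorem pieri4 (p : ℕ) : XM⁻¹ * sE (-(p : ℤ)) =
    RatFunc.C ((v ^ 3 * q ^ (p + 1) - v⁻¹) / (v ^ 2 * q ^ (p + 1) - 1)) *
      sE (-((p + 1 : ℕ) : ℤ)) -
    RatFunc.C ((v - v⁻¹) / (v ^ 2 * q ^ (p + 1) - 1)) * sE ((p : ℤ) + 1) := by
  rw [sub_eq_add_neg, ← neg_mul, ← map_neg, sE_pos, sE, sE, ev_neg_succ]
  refine lin1 _ _ _ _ _ _ _ _ _ _ _ (rec_neg p)
    (sc7 _ _ _ v_ne (ev_neg_ne p) (ht_ne (p + 1)) (ht2_ne (p + 1))) ?_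
  rw [neg_mul, sc4 _ _ _ v_ne (ht_ne (p + 1))]
  rfl

theorem sE_zero : sE 0 = 1 := by
  have h := E_zero
  rw [Nat.cast_zero, neg_zero] at h
  rw [sE, h, ev_C]
  simp

theorem sE_one : sE 1 = RatFunc.C v * XM := by
  have h := E_one
  rw [Nat.cast_zero, zero_add] at h
  rw [sE, h, ev_X, inv_inv]

/-- Pieri rules for the spherical nonsymmetric Macdonald polynomials:
`X·ℰ_n = ((t^{-1/2±1}·q^{-n} - t^{1/2})/(t^{±1}·q^{-n} - 1))·ℰ_{n+1}
        + ((t^{1/2} - t^{-1/2})/(t^{±1}·q^{-n} - 1))·ℰ_{1-n}` and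
`X⁻¹·ℰ_n = ((t^{1/2±1}·q^{-n+1} - t^{-1/2})/(t^{±1}·q^{-n+1} - 1))·ℰ_{n-1}
        - ((t^{1/2} - t^{-1/2})/(t^{±1}·q^{-n+1} - 1))·ℰ_{1-n}`,
where `± = +` if `n ≤ 0` and `± = -` if `n > 0`
(here `t^{±1} = t^{sgn n}`, `t^{-1/2±1} = v^{2·sgn n - 1}`, `t^{1/2±1} = v^{2·sgn n + 1}`). -/
theorem macdonald_pieri_rules (n : ℤ) :
    XM * sE n =
      RatFunc.C ((v ^ (2 * sgn n - 1) * q ^ (-n) - v) / (t ^ sgn n * q ^ (-n) - 1)) * sE (n + 1)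
      + RatFunc.C ((v - v⁻¹) / (t ^ sgn n * q ^ (-n) - 1)) * sE (1 - n) ∧
    XM⁻¹ * sE n =
      RatFunc.C ((v ^ (2 * sgn n + 1) * q ^ (-n + 1) - v⁻¹) / (t ^ sgn n * q ^ (-n + 1) - 1)) *
        sE (n - 1)
      - RatFunc.C ((v - v⁻¹) / (t ^ sgn n * q ^ (-n + 1) - 1)) * sE (1 - n) := by
  have hv := v_ne
  have hv1 : 1 - v ^ 2 ≠ 0 := by simpa [t] using ht_ne 0
  have hv2 : v ^ 2 - 1 ≠ 0 := by rw [← neg_sub]; exact neg_ne_zero.2 hv1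
  have ez : ∀ p : ℕ, q ^ (-((p : ℤ) + 1)) = (q ^ (p + 1))⁻¹ := fun p => by
    rw [zpow_neg, ← zpow_natCast]; push_cast; rfl
  have ez' : ∀ p : ℕ, q ^ ((p : ℤ) + 1) = q ^ (p + 1) := fun p => by
    rw [← zpow_natCast]; push_cast; rfl
  have e3 : v ^ (-3 : ℤ) = (v ^ 3)⁻¹ := by rw [zpow_neg]; rfl
  have e2 : t ^ (-1 : ℤ) = (v ^ 2)⁻¹ := by rw [zpow_neg, zpow_one, t]
  have e4 : v ^ (3 : ℤ) = v ^ 3 := rfl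
  have e1 : v ^ (-1 : ℤ) = v⁻¹ := zpow_neg_one v
  rcases lt_or_ge 0 n with hn | hn
  · obtain ⟨m, rfl⟩ : ∃ m : ℕ, n = (m : ℤ) + 1 := ⟨(n - 1).toNat, by omega⟩
    have hs : sgn ((m : ℤ) + 1) = -1 := if_neg (by omega)
    rw [hs]
    constructor
    · have h := pieri1 m
      rw [show 1 - ((m : ℤ) + 1) = -(m : ℤ) by ring, ez,
        show (2 * (-1) - 1 : ℤ) = -3 by norm_num, e3, e2]
      push_cast at h
      exact h
    · rcases Nat.eq_zero_or_pos m with rfl | hm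
      · have hk : -((v - v⁻¹) / ((v ^ 2)⁻¹ - 1)) = v := by
          have : (v ^ 2)⁻¹ - 1 = (1 - v ^ 2) / v ^ 2 := by field_simp
          rw [this]
          field_simp
          ring
        simp only [Nat.cast_zero, zero_add, sub_self, neg_add_cancel, zpow_zero, mul_one,
          sE_zero, sE_one, e2]
        rw [show (2 * (-1) + 1 : ℤ) = -1 by norm_num, e1, sub_self, zero_div, map_zero, zero_sub,
          ← map_neg, hk]
        have := XM_ne
        field_simp
      · obtain ⟨p, rfl⟩ : ∃ p, m = p + 1 := ⟨m - 1, by omega⟩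
        have h := pieri3 p
        rw [show 1 - (((p + 1 : ℕ) : ℤ) + 1) = -((p + 1 : ℕ) : ℤ) by ring,
          show -(((p + 1 : ℕ) : ℤ) + 1) + 1 = -((p : ℤ) + 1) by push_cast; ring,
          show ((p + 1 : ℕ) : ℤ) + 1 - 1 = (p : ℤ) + 1 by push_cast; ring,
          ez, show (2 * (-1) + 1 : ℤ) = -1 by norm_num, e1, e2]
        exact h
  · obtain ⟨m, rfl⟩ : ∃ m : ℕ, n = -(m : ℤ) := ⟨(-n).toNat, by omega⟩
    have hs : sgn (-(m : ℤ)) = 1 := if_pos hn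
    rw [hs, show (2 * 1 - 1 : ℤ) = 1 by norm_num, show (2 * 1 + 1 : ℤ) = 3 by norm_num,
      zpow_one, zpow_one, e4, neg_neg, show 1 - -(m : ℤ) = (m : ℤ) + 1 by ring, ez']
    constructor
    · rcases Nat.eq_zero_or_pos m with rfl | hm
      · have hk : (v - v⁻¹) / (v ^ 2 - 1) * v = 1 := by
          field_simp
        simp only [Nat.cast_zero, zero_add, neg_zero, zpow_zero, mul_one, sub_self, zero_div,
          map_zero, zero_mul, sE_zero, sE_one, t]
        rw [← mul_assoc, ← map_mul, hk, map_one, one_mul]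
      · obtain ⟨p, rfl⟩ : ∃ p, m = p + 1 := ⟨m - 1, by omega⟩
        have h := pieri2 p
        rw [show -((p + 1 : ℕ) : ℤ) + 1 = -(p : ℤ) by push_cast; ring, zpow_natCast]
        exact h
    · have h := pieri4 m
      rw [show -(m : ℤ) - 1 = -((m + 1 : ℕ) : ℤ) by push_cast; ring]
      exact h
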